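/- Let G be an infinite commutative group. A collection 𝓑 of finite nonempty subsets of G is a witness (i.e. M*(f) = inf_{B∈𝓑} sup_{t∈G} (f|B)(t) for every bounded f : G → ℝ) if and only if for every finite nonempty T ⊆ G, inf_{B∈𝓑} |B+T| / |B| = 1. -/

import Mathlib

open scoped Pointwise BigOperators
open Filter

/-- A real function on `G` is bounded. -/
def Bounded {G : Type*} (f : G → ℝ) : Prop :=
  ∃ C : ℝ, ∀ x, |f x| ≤ C

/-- An upper mean on the bounded real functions on a commutative group `G`. -/
structure IsUpperMean (G : Type*) [AddCommGroup G] (M : (G → ℝ) → ℝ) : Prop where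
  norming : ∀ c : ℝ, M (fun _ => c) = c
  mono : ∀ f g : G → ℝ, Bounded f → Bounded g → (∀ x, f x ≤ g x) → M f ≤ M g
  homog : ∀ c : ℝ, 0 ≤ c → ∀ f : G → ℝ, Bounded f → M (fun x => c * f x) = c * M f
  restr_add : ∀ f : G → ℝ, Bounded f → ∀ t : G, M (fun x => f x + f (x + t)) = 2 * M f
  subadd : ∀ f g : G → ℝ, Bounded f → Bounded g → M (fun x => f x + g x) ≤ M f + M g

/-- A lower mean on the bounded real functions on a commutative group `G`. -/
structure IsLowerMean (G : Type*) [AddCommGroup G] (M : (G → ℝ) → ℝ) : Prop where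
  norming : ∀ c : ℝ, M (fun _ => c) = c
  mono : ∀ f g : G → ℝ, Bounded f → Bounded g → (∀ x, f x ≤ g x) → M f ≤ M g
  homog : ∀ c : ℝ, 0 ≤ c → ∀ f : G → ℝ, Bounded f → M (fun x => c * f x) = c * M f
  restr_add : ∀ f : G → ℝ, Bounded f → ∀ t : G, M (fun x => f x + f (x + t)) = 2 * M f
  superadd : ∀ f g : G → ℝ, Bounded f → Bounded g → M f + M g ≤ M (fun x => f x + g x)

/-- `f` and `f'` are commarginal: marginals of a bounded `F` supported near the diagonal. -/
def Commarginal {G : Type*} [AddCommGroup G] (f f' : G → ℝ) : Prop :=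
  ∃ (F : G → G → ℝ) (B : Finset G),
    (∃ C : ℝ, ∀ x y, |F x y| ≤ C) ∧
    (∀ x y, F x y ≠ 0 → x - y ∈ B) ∧
    (∀ x, ∑ᶠ y, F x y = f x) ∧
    (∀ y, ∑ᶠ x, F x y = f' y)

/-- Uniform convergence of a sequence of functions. -/
def UnifLim {G : Type*} (g : ℕ → G → ℝ) (f : G → ℝ) : Prop :=
  ∀ ε : ℝ, 0 < ε → ∃ N : ℕ, ∀ n ≥ N, ∀ x, |g n x - f x| < ε

/-- `f` and `f'` are limit-commarginal. -/
def LimitCommarginal {G : Type*} [AddCommGroup G] (f f' : G → ℝ) : Prop :=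
  ∃ g g' : ℕ → G → ℝ, (∀ n, Bounded (g n)) ∧ (∀ n, Bounded (g' n)) ∧
    (∀ n, Commarginal (g n) (g' n)) ∧ UnifLim g f ∧ UnifLim g' f'

/-- `g` is a finite convex combination of translates of `f`. -/
def ConvexCombTranslates {G : Type*} [AddCommGroup G] (f g : G → ℝ) : Prop :=
  ∃ (n : ℕ) (c : Fin n → ℝ) (t : Fin n → G),
    (∀ i, 0 ≤ c i) ∧ (∑ i, c i) = 1 ∧ ∀ x, g x = ∑ i, c i * f (x + t i)

/-- The uppermost mean `M*`. -/
noncomputable def Mstar {G : Type*} [AddCommGroup G] (f : G → ℝ) : ℝ :=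
  sInf {a : ℝ | ∃ g : G → ℝ, ConvexCombTranslates f g ∧ a = sSup (Set.range g)}

/-- The lowest mean `M_*`. -/
noncomputable def Mlowstar {G : Type*} [AddCommGroup G] (f : G → ℝ) : ℝ :=
  sSup {a : ℝ | ∃ g : G → ℝ, ConvexCombTranslates f g ∧ a = sInf (Set.range g)}

/-- The `B`-average `(f|B)(t)` of `f`. -/
noncomputable def avg {G : Type*} [AddCommGroup G] (f : G → ℝ) (B : Finset G) (t : G) : ℝ :=
  (∑ b ∈ B, f (b + t)) / (B.card : ℝ)

/-- The expansion pseudomean `E(f)`. -/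
noncomputable def Epm {G : Type*} [AddCommGroup G] [DecidableEq G] (f : G → ℝ) : ℝ :=
  ⨅ T : {T : Finset G // T.Nonempty}, ⨆ B : {B : Finset G // B.Nonempty},
    (∑ b ∈ B.1, f b) / (((B.1 + T.1).card : ℝ))

/-- A finite nonempty `Y ⊆ G` is a tile: some set `Z` of translates partitions `G`. -/
def IsTile {G : Type*} [AddCommGroup G] (Y : Finset G) : Prop :=
  Y.Nonempty ∧ ∃ Z : Set G, ∀ x : G, ∃! p : Y × Z, (p.1 : G) + (p.2 : G) = x

theorem ConvexCombTranslates.abs_le {G : Type*} [AddCommGroup G] {f g : G → ℝ} {C : ℝ}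
    (hC : ∀ x, |f x| ≤ C) (hg : ConvexCombTranslates f g) (x : G) : |g x| ≤ C := by
  obtain ⟨n, c, t, hc, hc1, hg⟩ := hg
  rw [hg]
  calc |∑ i, c i * f (x + t i)| ≤ ∑ i, |c i * f (x + t i)| := Finset.abs_sum_le_sum_abs _ _
    _ ≤ ∑ i, c i * C := Finset.sum_le_sum fun i _ => by
        rw [abs_mul, abs_of_nonneg (hc i)]
        exact mul_le_mul_of_nonneg_left (hC _) (hc i)
    _ = C := by rw [← Finset.sum_mul, hc1, one_mul]

theorem ConvexCombTranslates.of_fintype {G ι : Type*} [AddCommGroup G] [Fintype ι] [Nonempty ι]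
    (f : G → ℝ) (t : ι → G) :
    ConvexCombTranslates f (fun x => (∑ i, f (x + t i)) / (Fintype.card ι : ℝ)) := by
  have hpos : (0 : ℝ) < Fintype.card ι := by exact_mod_cast Fintype.card_pos
  refine ⟨Fintype.card ι, fun _ => (Fintype.card ι : ℝ)⁻¹,
    fun i => t ((Fintype.equivFin ι).symm i), fun _ => by positivity, ?_, fun x => ?_⟩
  · simp [hpos.ne']
  · beta_reduce
    rw [← Finset.mul_sum, Equiv.sum_comp (Fintype.equivFin ι).symm (fun i => f (x + t i)),
      div_eq_inv_mul]

theorem Mstar_le_sSup {G : Type*} [AddCommGroup G] {f g : G → ℝ} (hf : Bounded f)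
    (hg : ConvexCombTranslates f g) : Mstar f ≤ sSup (Set.range g) := by
  obtain ⟨C, hC⟩ := hf
  refine csInf_le ⟨-C, ?_⟩ ⟨g, hg, rfl⟩
  rintro _ ⟨k, hk, rfl⟩
  have hb : BddAbove (Set.range k) :=
    ⟨C, by rintro _ ⟨x, rfl⟩; exact (abs_le.1 (hk.abs_le hC x)).2⟩
  exact (abs_le.1 (hk.abs_le hC 0)).1.trans (le_csSup hb ⟨0, rfl⟩)

theorem Mstar_le_of_sum_le {G ι : Type*} [AddCommGroup G] [Fintype ι] [Nonempty ι] {f : G → ℝ}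
    (hf : Bounded f) (t : ι → G) {a : ℝ} (h : ∀ x, ∑ i, f (x + t i) ≤ a * Fintype.card ι) :
    Mstar f ≤ a := by
  have hpos : (0 : ℝ) < Fintype.card ι := by exact_mod_cast Fintype.card_pos
  refine (Mstar_le_sSup hf (.of_fintype f t)).trans (csSup_le (Set.range_nonempty _) ?_)
  rintro _ ⟨x, rfl⟩
  exact (div_le_iff₀ hpos).2 (h x)

theorem Mstar_const {G : Type*} [AddCommGroup G] (c : ℝ) : Mstar (fun _ : G => c) = c := by
  have : {a : ℝ | ∃ g : G → ℝ, ConvexCombTranslates (fun _ => c) g ∧ a = sSup (Set.range g)}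
      = {c} := by
    ext a
    constructor
    · rintro ⟨g, ⟨n, k, t, -, hk, hg⟩, rfl⟩
      have : g = fun _ => c := funext fun x => by rw [hg, ← Finset.sum_mul, hk, one_mul]
      simp [this]
    · rintro rfl
      exact ⟨fun _ => a, ⟨1, fun _ => 1, fun _ => 0, by simp, by simp, by simp⟩, by simp⟩
  rw [Mstar, this, csInf_singleton]

theorem abs_avg_le {G : Type*} [AddCommGroup G] {f : G → ℝ} {C : ℝ} (hC : ∀ x, |f x| ≤ C)
    {B : Finset G} (hB : B.Nonempty) (t : G) : |avg f B t| ≤ C := by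
  have hpos : (0 : ℝ) < B.card := by exact_mod_cast hB.card_pos
  rw [avg, abs_div, abs_of_pos hpos, div_le_iff₀ hpos]
  calc |∑ b ∈ B, f (b + t)| ≤ ∑ b ∈ B, |f (b + t)| := Finset.abs_sum_le_sum_abs _ _
    _ ≤ ∑ _b ∈ B, C := Finset.sum_le_sum fun _ _ => hC _
    _ = C * B.card := by rw [Finset.sum_const, nsmul_eq_mul, mul_comm]

theorem avg_le_iSup_avg {G : Type*} [AddCommGroup G] {f : G → ℝ} (hf : Bounded f)
    {B : Finset G} (hB : B.Nonempty) (t : G) : avg f B t ≤ ⨆ t, avg f B t := by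
  obtain ⟨C, hC⟩ := hf
  exact le_ciSup (f := fun t => avg f B t)
    ⟨C, by rintro _ ⟨x, rfl⟩; exact (abs_le.1 (abs_avg_le hC hB x)).2⟩ t

theorem Mstar_le_iSup_avg {G : Type*} [AddCommGroup G] {f : G → ℝ} (hf : Bounded f)
    {B : Finset G} (hB : B.Nonempty) : Mstar f ≤ ⨆ t, avg f B t := by
  have hpos : (0 : ℝ) < B.card := by exact_mod_cast hB.card_pos
  have : Nonempty B := hB.to_subtype
  refine Mstar_le_of_sum_le hf (fun b : B => (b : G)) fun x => ?_
  rw [Finset.sum_coe_sort B (fun b => f (x + b)), Fintype.card_coe, ← div_le_iff₀ hpos]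
  simpa only [avg, add_comm x] using avg_le_iSup_avg hf hB x

/-- A set that barely expands under `T` nearly averages out translations by `t ∈ T`. -/
theorem sum_le_sum_translate_add {G : Type*} [AddCommGroup G] [DecidableEq G] {f : G → ℝ} {C : ℝ}
    (hC : ∀ x, |f x| ≤ C) {B T : Finset G} (h0 : 0 ∈ T) {t : G} (ht : t ∈ T) (x : G) :
    ∑ b ∈ B, f (b + x) ≤
      ∑ b ∈ B, f (b + x + t) + 2 * C * (((B + T).card : ℝ) - B.card) := by
  have h1 : B ⊆ B + T := fun b hb => by simpa using Finset.add_mem_add hb h0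
  have h2 : B.image (· + t) ⊆ B + T := by
    intro y hy
    obtain ⟨b, hb, rfl⟩ := Finset.mem_image.1 hy
    exact Finset.add_mem_add hb ht
  have hcard : (B.image (· + t)).card = B.card :=
    Finset.card_image_of_injective _ (add_left_injective t)
  have h3 : ∑ b ∈ B, (f (b + x) + C) ≤ ∑ y ∈ B + T, (f (y + x) + C) :=
    Finset.sum_le_sum_of_subset_of_nonneg h1 fun y _ _ => by
      have := (abs_le.1 (hC (y + x))).1
      linarith
  have h4 : ∑ y ∈ (B + T) \ B.image (· + t), (f (y + x) + C) ≤
      ∑ _y ∈ (B + T) \ B.image (· + t), 2 * C :=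
    Finset.sum_le_sum fun y _ => by
      have := (abs_le.1 (hC (y + x))).2
      linarith
  have h5 : ∑ y ∈ B.image (· + t), (f (y + x) + C) = ∑ b ∈ B, (f (b + x + t) + C) := by
    rw [Finset.sum_image fun a _ b _ h => add_left_injective t h]
    exact Finset.sum_congr rfl fun b _ => by rw [add_right_comm]
  rw [← Finset.sum_sdiff h2, h5] at h3
  rw [Finset.sum_const, Finset.card_sdiff_of_subset h2, hcard, nsmul_eq_mul,
    Nat.cast_sub (Finset.card_le_card h1)] at h4
  simp only [Finset.sum_add_distrib] at h3 h4
  linarith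

/-- Sums of coboundaries `h - h (· + s)`, `s ∈ T`, have arbitrarily small averages. -/
theorem exists_sum_coboundary_le {G : Type*} [AddCommGroup G] [DecidableEq G] {h : G → ℝ}
    (h0 : ∀ x, 0 ≤ h x) (h1 : ∀ x, h x ≤ 1) (T : Finset G) {ε : ℝ} (hε : 0 < ε) :
    ∃ (ι : Type) (_ : Fintype ι) (_ : Nonempty ι) (t : ι → G),
      ∀ x, ∑ i, ∑ s ∈ T, (h (x + t i) - h (x + t i + s)) ≤ T.card * ε * Fintype.card ι := by
  induction T using Finset.induction_on with
  | empty => exact ⟨Unit, inferInstance, inferInstance, fun _ => 0, by simp⟩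
  | insert s T hs ih =>
    obtain ⟨ι, _, _, t, ht⟩ := ih
    obtain ⟨n, hn⟩ := exists_nat_gt (1 / ε)
    have hnpos : (0 : ℝ) < n := (by positivity : 0 < 1 / ε).trans hn
    have hn1 : 1 ≤ ε * n := by
      rw [div_lt_iff₀ hε] at hn
      linarith
    have : NeZero n := ⟨by rintro rfl; simp at hnpos⟩
    refine ⟨ι × Fin n, inferInstance, inferInstance, fun p => t p.1 + (p.2 : ℕ) • s, fun x => ?_⟩
    simp only [Finset.sum_insert hs, Finset.sum_add_distrib, Finset.card_insert_of_notMem hs]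
    have hA : ∑ p : ι × Fin n, (h (x + (t p.1 + (p.2 : ℕ) • s)) -
        h (x + (t p.1 + (p.2 : ℕ) • s) + s)) ≤ Fintype.card ι := by
      rw [Fintype.sum_prod_type]
      have : ∀ i : ι, ∑ k : Fin n, (h (x + (t i + (k : ℕ) • s)) -
          h (x + (t i + (k : ℕ) • s) + s)) ≤ 1 := fun i => by
        rw [Fin.sum_univ_eq_sum_range
          (fun k : ℕ => h (x + (t i + k • s)) - h (x + (t i + k • s) + s)) n]
        have : ∀ k : ℕ, h (x + (t i + k • s) + s) = h (x + (t i + (k + 1) • s)) := fun k => by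
          rw [succ_nsmul, add_assoc, add_assoc]
        simp only [this]
        rw [Finset.sum_range_sub' (fun k => h (x + (t i + k • s)))]
        linarith [h1 (x + (t i + 0 • s)), h0 (x + (t i + n • s))]
      simpa using Finset.sum_le_sum fun i (_ : i ∈ Finset.univ) => this i
    have hB : ∑ p : ι × Fin n, ∑ r ∈ T, (h (x + (t p.1 + (p.2 : ℕ) • s)) -
        h (x + (t p.1 + (p.2 : ℕ) • s) + r)) ≤ n * (T.card * ε * Fintype.card ι) := by
      rw [Fintype.sum_prod_type_right]
      have : ∀ k : Fin n, ∑ i : ι, ∑ r ∈ T, (h (x + (t i + (k : ℕ) • s)) -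
          h (x + (t i + (k : ℕ) • s) + r)) ≤ T.card * ε * Fintype.card ι := fun k => by
        have e : ∀ i, x + (t i + (k : ℕ) • s) = x + (k : ℕ) • s + t i := fun i => by abel
        simpa only [e] using ht (x + (k : ℕ) • s)
      simpa using Finset.sum_le_sum fun k (_ : k ∈ Finset.univ) => this k
    have hι : (0 : ℝ) ≤ Fintype.card ι := Nat.cast_nonneg _
    simp only [Fintype.card_prod, Fintype.card_fin]
    push_cast
    nlinarith [mul_le_mul_of_nonneg_right hn1 hι]

universe u in
theorem exists_forall_notMem_of_mk_lt {ι β : Type u} [Infinite β]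
    (hι : Cardinal.mk ι < Cardinal.mk β) (s : ι → Finset β) : ∃ z, ∀ i, z ∉ s i := by
  by_contra! hcon
  have hU : (⋃ i, (s i : Set β)) = Set.univ := Set.eq_univ_of_forall fun z => by simpa using hcon z
  cases finite_or_infinite ι with
  | inl _ =>
    exact Set.infinite_univ (hU ▸ Set.finite_iUnion fun i => (s i).finite_toSet)
  | inr _ =>
    refine hι.not_ge ?_
    calc Cardinal.mk β = Cardinal.mk (⋃ i, (s i : Set β)) := by rw [hU, Cardinal.mk_univ]
      _ ≤ Cardinal.sum fun i => Cardinal.mk (s i : Set β) := Cardinal.mk_iUnion_le_sum_mk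
      _ ≤ Cardinal.sum fun _ : ι => Cardinal.aleph0 :=
        Cardinal.sum_le_sum _ _ fun i => (Cardinal.finset_card_lt_aleph0 (s i)).le
      _ = Cardinal.mk ι := by
        rw [Cardinal.sum_const', Cardinal.mul_aleph0_eq (Cardinal.aleph0_le_mk ι)]

universe u in
/-- Values chosen along a well-order of small initial segments can avoid finitely many obstructions
from each earlier value. -/
theorem exists_avoiding {α β : Type u} [Infinite β] (hαβ : Cardinal.mk α ≤ Cardinal.mk β)
    (bad : α → α → β → Finset β) :
    ∃ x : α → β, ∀ a b, a ≠ b → x a ∉ bad a b (x b) ∨ x b ∉ bad b a (x a) := by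
  obtain ⟨r, _, hr⟩ := Cardinal.exists_ord_eq α
  have hwf : WellFounded r := IsWellFounded.wf
  have hex : ∀ (a : α) (y : ∀ b, r b a → β), ∃ z, ∀ b (hb : r b a), z ∉ bad a b (y b hb) := by
    intro a y
    have hseg : Cardinal.mk {b // r b a} < Cardinal.mk β :=
      (Ordinal.card_typein (r := r) a ▸ Cardinal.card_typein_lt a hr).trans_le hαβ
    obtain ⟨z, hz⟩ := exists_forall_notMem_of_mk_lt hseg fun b => bad a b (y b b.2)
    exact ⟨z, fun b hb => hz ⟨b, hb⟩⟩
  choose F hF using hex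
  let x : α → β := hwf.fix fun a y => F a y
  have hx : ∀ a b, r b a → x a ∉ bad a b (x b) := fun a b hb => by
    have : x a = F a fun b _ => x b := hwf.fix_eq _ a
    rw [this]
    exact hF a (fun b _ => x b) b hb
  refine ⟨x, fun a b hab => ?_⟩
  rcases trichotomous_of r a b with h | h | h
  · exact .inr (hx b a h)
  · exact absurd h hab
  · exact .inl (hx a b h)

theorem exists_separating_translates {G : Type*} [AddCommGroup G] [Infinite G] [DecidableEq G]
    (T : Finset G) :
    ∃ x : Finset G → G, ∀ A B, A ≠ B → ∀ a ∈ A, ∀ b ∈ B, ∀ t ∈ T, a + x A + t ≠ b + x B := by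
  obtain ⟨x, hx⟩ := exists_avoiding (α := Finset G) (β := G)
    (by rw [Cardinal.mk_finset_of_infinite])
    (fun A B y => (B - A - T + {y}) ∪ (B + T - A + {y}))
  refine ⟨x, fun A B hAB a ha b hb t ht h => ?_⟩
  rcases hx A B hAB with h' | h'
  · refine h' (Finset.mem_union_left _ ?_)
    have : x A = b - a - t + x B := by
      rw [eq_sub_of_add_eq h.symm]
      abel
    rw [this]
    exact Finset.add_mem_add (Finset.sub_mem_sub (Finset.sub_mem_sub hb ha) ht)
      (Finset.mem_singleton_self _)
  · refine h' (Finset.mem_union_right _ ?_)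
    have : x B = a + t - b + x A := by
      rw [eq_sub_of_add_eq' h.symm]
      abel
    rw [this]
    exact Finset.add_mem_add (Finset.sub_mem_sub (Finset.add_mem_add ha ht) hb)
      (Finset.mem_singleton_self _)

theorem card_add_le_card_add_sum {G : Type*} [AddCommGroup G] [DecidableEq G] (B T : Finset G) :
    (B + T).card ≤ B.card + ∑ t ∈ T, (B.filter fun b => b + t ∉ B).card := by
  have : B + T ⊆ B ∪ T.biUnion fun t => (B.filter fun b => b + t ∉ B).image (· + t) := by
    intro y hy
    obtain ⟨b, hb, t, ht, rfl⟩ := Finset.mem_add.1 hy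
    by_cases hbt : b + t ∈ B
    · exact Finset.mem_union_left _ hbt
    · exact Finset.mem_union_right _ (Finset.mem_biUnion.2
        ⟨t, ht, Finset.mem_image_of_mem _ (Finset.mem_filter.2 ⟨hb, hbt⟩)⟩)
  calc (B + T).card ≤ _ := Finset.card_le_card this
    _ ≤ _ := Finset.card_union_le _ _
    _ ≤ _ := by
      gcongr
      exact Finset.card_biUnion_le.trans (Finset.sum_le_sum fun t _ => Finset.card_image_le)

theorem one_le_card_add_div_card {G : Type*} [AddCommGroup G] [DecidableEq G] {B T : Finset G}
    (hB : B.Nonempty) (hT : T.Nonempty) : (1 : ℝ) ≤ ((B + T).card : ℝ) / B.card := by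
  rw [one_le_div (by exact_mod_cast hB.card_pos)]
  exact_mod_cast Finset.card_le_card_add_right hT

/-- If every member of `𝓑` expands by a definite factor under `T`, a sum of coboundaries of the
indicator of a union of separated translates detects it. -/
theorem exists_Mstar_lt_of_expanding {G : Type*} [AddCommGroup G] [Infinite G] [DecidableEq G]
    {𝓑 : Set (Finset G)} (h𝓑 : ∀ B ∈ 𝓑, B.Nonempty) (T : Finset G) {δ : ℝ}
    (h : ∀ B ∈ 𝓑, (1 + δ) * B.card ≤ ((B + T).card : ℝ)) :
    ∃ f : G → ℝ, Bounded f ∧ Mstar f ≤ 0 ∧ ∀ B ∈ 𝓑, δ ≤ ⨆ t, avg f B t := by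
  classical
  obtain ⟨x, hx⟩ := exists_separating_translates T
  set S : Set G := {y | ∃ B ∈ 𝓑, ∃ b ∈ B, b + x B = y}
  set u : G → ℝ := fun y => if y ∈ S then 1 else 0 with hu
  have u0 : ∀ y, 0 ≤ u y := fun y => by simp only [hu]; split_ifs <;> norm_num
  have u1 : ∀ y, u y ≤ 1 := fun y => by simp only [hu]; split_ifs <;> norm_num
  have hf : Bounded fun y => ∑ s ∈ T, (u y - u (y + s)) := by
    refine ⟨T.card, fun y => (Finset.abs_sum_le_sum_abs _ _).trans ?_⟩
    rw [← nsmul_one, ← Finset.sum_const]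
    exact Finset.sum_le_sum fun s _ => abs_le.2
      ⟨by linarith [u0 y, u1 (y + s)], by linarith [u1 y, u0 (y + s)]⟩
  refine ⟨fun y => ∑ s ∈ T, (u y - u (y + s)), hf, ?_, fun B hB => ?_⟩
  · refine le_of_forall_pos_le_add fun ε hε => ?_
    obtain ⟨ι, _, _, t, ht⟩ := exists_sum_coboundary_le u0 u1 T
      (ε := ε / (T.card + 1)) (by positivity)
    refine Mstar_le_of_sum_le hf t fun y => (ht y).trans ?_
    rw [zero_add]
    gcongr
    rw [mul_div_assoc', div_le_iff₀ (by positivity)]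
    linarith
  · refine le_trans ?_ (avg_le_iSup_avg hf (h𝓑 B hB) (x B))
    have hpos : (0 : ℝ) < B.card := by exact_mod_cast (h𝓑 B hB).card_pos
    rw [avg, le_div_iff₀ hpos, Finset.sum_comm]
    have key : ∀ s ∈ T, ((B.filter fun b => b + s ∉ B).card : ℝ) ≤
        ∑ b ∈ B, (u (b + x B) - u (b + x B + s)) := by
      intro s hs
      rw [Finset.card_filter]
      push_cast
      refine Finset.sum_le_sum fun b hb => ?_
      have hb1 : u (b + x B) = 1 := if_pos ⟨B, hB, b, hb, rfl⟩
      rw [hb1]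
      split_ifs with hbs
      · linarith [u1 (b + x B + s)]
      · have : u (b + x B + s) = 0 := by
          refine if_neg ?_
          rintro ⟨B', -, b', hb', he⟩
          by_cases hBB : B = B'
          · subst hBB
            rw [add_right_comm] at he
            exact hbs (add_right_cancel he ▸ hb')
          · exact hx B B' hBB b hb b' hb' s hs he.symm
        rw [this, sub_zero]
    have hcard : ((B + T).card : ℝ) ≤
        B.card + ∑ s ∈ T, ((B.filter fun b => b + s ∉ B).card : ℝ) := by
      exact_mod_cast card_add_le_card_add_sum B T
    linarith [h B hB, Finset.sum_le_sum key]

/-- a collection of finite nonempty sets is a witness iff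
`inf_{B ∈ 𝓑} |B+T|/|B| = 1` for every finite nonempty `T`. -/
theorem stmt13 {G : Type*} [AddCommGroup G] [Infinite G] [DecidableEq G]
    (𝓑 : Set (Finset G)) (h𝓑 : ∀ B ∈ 𝓑, B.Nonempty) :
    (∀ f : G → ℝ, Bounded f →
        Mstar f = sInf {a : ℝ | ∃ B ∈ 𝓑, a = ⨆ t : G, avg f B t}) ↔
    (∀ T : Finset G, T.Nonempty →
        sInf {r : ℝ | ∃ B ∈ 𝓑, r = ((B + T).card : ℝ) / (B.card : ℝ)} = 1) := by
  constructor
  · intro H T hT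
    have hne : 𝓑.Nonempty := by
      by_contra hempty
      rw [Set.not_nonempty_iff_eq_empty] at hempty
      have := H (fun _ => 1) ⟨1, by simp⟩
      simp [Mstar_const, hempty] at this
    have hlb : ∀ r ∈ {r : ℝ | ∃ B ∈ 𝓑, r = ((B + T).card : ℝ) / (B.card : ℝ)}, 1 ≤ r := by
      rintro _ ⟨B, hB, rfl⟩
      exact one_le_card_add_div_card (h𝓑 B hB) hT
    obtain ⟨B₀, hB₀⟩ := hne
    refine le_antisymm (not_lt.1 fun hlt => ?_) (le_csInf ⟨_, B₀, hB₀, rfl⟩ hlb)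
    set m := sInf {r : ℝ | ∃ B ∈ 𝓑, r = ((B + T).card : ℝ) / (B.card : ℝ)}
    obtain ⟨f, hf, hf0, hfB⟩ := exists_Mstar_lt_of_expanding h𝓑 T (δ := m - 1) fun B hB => by
      rw [add_sub_cancel, ← le_div_iff₀ (by exact_mod_cast (h𝓑 B hB).card_pos)]
      exact csInf_le ⟨1, hlb⟩ ⟨B, hB, rfl⟩
    have : m - 1 ≤ Mstar f := by
      rw [H f hf]
      refine le_csInf ⟨_, B₀, hB₀, rfl⟩ ?_
      rintro _ ⟨B, hB, rfl⟩
      exact hfB B hB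
    linarith
  · intro H f hf
    have hlb : ∀ a ∈ {a : ℝ | ∃ B ∈ 𝓑, a = ⨆ t : G, avg f B t}, Mstar f ≤ a := by
      rintro _ ⟨B, hB, rfl⟩
      exact Mstar_le_iSup_avg hf (h𝓑 B hB)
    have hne : 𝓑.Nonempty := by
      by_contra hempty
      rw [Set.not_nonempty_iff_eq_empty] at hempty
      have := H {0} (Finset.singleton_nonempty 0)
      simp [hempty] at this
    obtain ⟨B₀, hB₀⟩ := hne
    refine le_antisymm (le_csInf ⟨_, B₀, hB₀, rfl⟩ hlb) ?_
    obtain ⟨C, hC⟩ := hf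
    have hC0 : 0 ≤ C := (abs_nonneg _).trans (hC 0)
    refine le_csInf ⟨_, _, ConvexCombTranslates.of_fintype f (fun _ : Unit => (0 : G)), rfl⟩ ?_
    rintro _ ⟨g, hg, rfl⟩
    have hga : ∀ x, g x ≤ sSup (Set.range g) := fun x =>
      le_csSup ⟨C, by rintro _ ⟨x, rfl⟩; exact (abs_le.1 (hg.abs_le hC x)).2⟩ ⟨x, rfl⟩
    obtain ⟨n, c, t, hc, hc1, hgx⟩ := hg
    refine le_of_forall_pos_le_add fun ε hε => ?_
    set T : Finset G := insert 0 (Finset.univ.image t)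
    obtain ⟨_, ⟨B, hB, rfl⟩, hlt⟩ := exists_lt_of_csInf_lt
      (s := {r : ℝ | ∃ B ∈ 𝓑, r = ((B + T).card : ℝ) / (B.card : ℝ)}) ⟨_, B₀, hB₀, rfl⟩
      ((H T ⟨0, Finset.mem_insert_self _ _⟩).trans_lt
        (by linarith [show 0 < ε / (2 * C + 1) by positivity] : (1 : ℝ) < 1 + ε / (2 * C + 1)))
    have hpos : (0 : ℝ) < B.card := by exact_mod_cast (h𝓑 B hB).card_pos
    rw [div_lt_iff₀ hpos] at hlt
    have hsmall : 2 * C * (((B + T).card : ℝ) - B.card) ≤ ε * B.card := by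
      calc 2 * C * (((B + T).card : ℝ) - B.card)
          ≤ 2 * C * (ε / (2 * C + 1) * B.card) := by gcongr; linarith
        _ = 2 * C * ε / (2 * C + 1) * B.card := by ring
        _ ≤ ε * B.card := by
          gcongr
          rw [div_le_iff₀ (by positivity)]
          linarith
    refine (csInf_le ⟨_, hlb⟩ ⟨B, hB, rfl⟩).trans (ciSup_le fun x => ?_)
    rw [avg, div_le_iff₀ hpos]
    calc ∑ b ∈ B, f (b + x) = ∑ i, c i * ∑ b ∈ B, f (b + x) := by
          rw [← Finset.sum_mul, hc1, one_mul]
      _ ≤ ∑ i, c i * (∑ b ∈ B, f (b + x + t i) + ε * B.card) := by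
          refine Finset.sum_le_sum fun i _ => mul_le_mul_of_nonneg_left ?_ (hc i)
          have := sum_le_sum_translate_add hC (B := B) (T := T) (Finset.mem_insert_self _ _)
            (Finset.mem_insert_of_mem (Finset.mem_image_of_mem t (Finset.mem_univ i))) x
          linarith
      _ = ∑ b ∈ B, g (b + x) + ε * B.card := by
          simp only [mul_add, Finset.sum_add_distrib, ← Finset.sum_mul, hc1, one_mul, hgx,
            Finset.mul_sum]
          rw [Finset.sum_comm]
      _ ≤ ∑ _b ∈ B, sSup (Set.range g) + ε * B.card := by
          gcongr
          exact hga _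
      _ = (sSup (Set.range g) + ε) * B.card := by
          rw [Finset.sum_const, nsmul_eq_mul]
          ring
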